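/- (Hall's condition for S-trees) Let S be an S-tree and let U be a nonempty subset of Core(S). Then |N(U) ∩ Supp(S)| > |U|, where N(U) is the set of vertices having a neighbor in U. -/

import Mathlib

open scoped Classical

namespace NullDecomp

variable {V : Type*}

/-- The null space of the real adjacency matrix of a graph. -/
def nullSpace [Fintype V] (G : SimpleGraph V) : Set (V → ℝ) :=
  {x | Matrix.mulVec (G.adjMatrix ℝ) x = 0}

/-- The support of the null space: vertices with a nonzero entry in some null vector. -/
def supportSet [Fintype V] (G : SimpleGraph V) : Set V :=
  {v | ∃ x ∈ nullSpace G, x v ≠ 0}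

/-- The (open) neighborhood of a set of vertices. -/
def nbhdSet (G : SimpleGraph V) (A : Set V) : Set V :=
  {v | ∃ u ∈ A, G.Adj u v}

/-- The closed neighborhood of a set of vertices. -/
def closedNbhd (G : SimpleGraph V) (A : Set V) : Set V :=
  A ∪ nbhdSet G A

/-- The core of a graph: the neighborhood of the support of the null space. -/
def coreSet [Fintype V] (G : SimpleGraph V) : Set V :=
  nbhdSet G (supportSet G)

/-- A tree is an S-tree if the closed neighborhood of its support is everything. -/
def IsSTree [Fintype V] (G : SimpleGraph V) : Prop :=
  G.IsTree ∧ closedNbhd G (supportSet G) = Set.univ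

/-- A matching: a set of edges of `G`, pairwise disjoint. -/
def IsMatchingSet (G : SimpleGraph V) (M : Finset (Sym2 V)) : Prop :=
  (↑M : Set (Sym2 V)) ⊆ G.edgeSet ∧
    ∀ e ∈ M, ∀ f ∈ M, e ≠ f → ∀ v : V, v ∈ e → v ∉ f

/-- A maximum matching. -/
def IsMaxMatching [Fintype V] (G : SimpleGraph V) (M : Finset (Sym2 V)) : Prop :=
  IsMatchingSet G M ∧ ∀ M' : Finset (Sym2 V), IsMatchingSet G M' → M'.card ≤ M.card

/-- The matching number. -/
noncomputable def matchingNumber [Fintype V] (G : SimpleGraph V) : ℕ :=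
  sSup {n | ∃ M : Finset (Sym2 V), IsMatchingSet G M ∧ M.card = n}

/-- An independent set of vertices. -/
def IsIndep (G : SimpleGraph V) (A : Set V) : Prop :=
  ∀ u ∈ A, ∀ w ∈ A, ¬ G.Adj u w

/-- The independence number. -/
noncomputable def indepNumber [Fintype V] (G : SimpleGraph V) : ℕ :=
  sSup {n | ∃ A : Set V, IsIndep G A ∧ A.ncard = n}

/-- A vertex cover. -/
def IsVertexCover (G : SimpleGraph V) (Cs : Set V) : Prop :=
  ∀ e ∈ G.edgeSet, ∃ v ∈ Cs, v ∈ e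

/-- The vertex cover number. -/
noncomputable def coverNumber [Fintype V] (G : SimpleGraph V) : ℕ :=
  sInf {n | ∃ Cs : Set V, IsVertexCover G Cs ∧ Cs.ncard = n}

/-- The nullity of a graph: dimension of the kernel of its adjacency matrix. -/
noncomputable def nullity [Fintype V] (G : SimpleGraph V) : ℕ :=
  Module.finrank ℝ (LinearMap.ker (Matrix.mulVecLin (G.adjMatrix ℝ)))

/-- The number of maximum matchings of a graph. -/
noncomputable def numMaxMatchings [Fintype V] (G : SimpleGraph V) : ℕ :=
  Set.ncard {M : Finset (Sym2 V) | IsMaxMatching G M}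

/-- `C` is (the vertex set of) a connected component of the subgraph of `T`
induced by the closed neighborhood of the support of `T`. -/
def IsSComponent [Fintype V] (T : SimpleGraph V) (C : Set V) : Prop :=
  ∃ c : (T.induce (closedNbhd T (supportSet T))).ConnectedComponent,
    C = Subtype.val '' c.supp

/-- `C` is (the vertex set of) a connected component of the subgraph of `T`
induced by the complement of the closed neighborhood of the support of `T`. -/
def IsNComponent [Fintype V] (T : SimpleGraph V) (C : Set V) : Prop :=
  ∃ c : (T.induce ((closedNbhd T (supportSet T))ᶜ)).ConnectedComponent,
    C = Subtype.val '' c.supp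

/-- The zero-extension to `ℝ^V` of the null space of the subgraph of `T` induced by `C`:
vectors vanishing outside `C` whose restriction to `C` is a null vector of `T.induce C`. -/
noncomputable def extNull [Fintype V] (T : SimpleGraph V) (C : Set V) : Submodule ℝ (V → ℝ) :=
  LinearMap.ker ((Matrix.mulVecLin ((T.induce C).adjMatrix ℝ)).comp
      (LinearMap.funLeft ℝ ℝ (Subtype.val : ↥C → V))) ⊓
  LinearMap.ker (LinearMap.funLeft ℝ ℝ (Subtype.val : ↥(Cᶜ) → V))

lemma isAcyclic_card_edgeFinset_lt {P : Type*} [Fintype P] [Nonempty P] {H : SimpleGraph P}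
    (hH : H.IsAcyclic) : H.edgeFinset.card < Fintype.card P := by
  obtain ⟨T, hHT, -, hT⟩ :=
    SimpleGraph.connected_top.exists_isTree_le_of_le_of_isAcyclic (le_top : H ≤ ⊤) hH
  have h := hT.card_edgeFinset
  have := Finset.card_le_card (SimpleGraph.edgeFinset_subset_edgeFinset.2 hHT)
  omega

lemma card_lt_card_of_two_le_degree {P : Type*} [Fintype P] {H : SimpleGraph P}
    (hH : H.IsAcyclic) {s t : Finset P} (hst : H.IsBipartiteWith s t)
    (hcover : ∀ p, p ∈ s ∪ t) (hs : s.Nonempty) (hdeg : ∀ p ∈ s, 2 ≤ H.degree p) :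
    s.card < t.card := by
  have : Nonempty P := ⟨hs.choose⟩
  have hlt := isAcyclic_card_edgeFinset_lt hH
  rw [← SimpleGraph.isBipartiteWith_sum_degrees_eq_card_edges hst] at hlt
  have hle := Finset.card_nsmul_le_sum s _ 2 hdeg
  have hcard : Fintype.card P ≤ s.card + t.card := by
    rw [← Finset.card_univ, ← Finset.eq_univ_iff_forall.2 hcover]
    exact Finset.card_union_le s t
  rw [smul_eq_mul] at hle
  omega

lemma mem_nullSpace_iff [Fintype V] {G : SimpleGraph V} {x : V → ℝ} :
    x ∈ nullSpace G ↔ ∀ v, ∑ w ∈ G.neighborFinset v, x w = 0 := by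
  simp [nullSpace, funext_iff, SimpleGraph.adjMatrix_mulVec_apply]

/-- Restricting a null vector to one color class of a 2-coloring gives a null vector. -/
lemma restrict_color_mem_nullSpace [Fintype V] {G : SimpleGraph V} (C : G.Coloring (Fin 2))
    (i : Fin 2) {x : V → ℝ} (hx : x ∈ nullSpace G) :
    (fun w ↦ if C w = i then x w else 0) ∈ nullSpace G := by
  rw [mem_nullSpace_iff] at hx ⊢
  intro v
  by_cases hv : C v = i
  · refine Finset.sum_eq_zero fun w hw ↦ if_neg ?_
    rw [SimpleGraph.mem_neighborFinset] at hw
    exact fun h ↦ C.valid hw (hv.trans h.symm)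
  · rw [← hx v]
    refine Finset.sum_congr rfl fun w hw ↦ if_pos ?_
    rw [SimpleGraph.mem_neighborFinset] at hw
    have := C.valid hw
    omega

/-- The support of the null space of a forest is an independent set: for an edge `uv`, pair null
vectors living on opposite color classes over the component of `u` left when `uv` is removed. -/
lemma isIndep_supportSet [Fintype V] {G : SimpleGraph V} (hG : G.IsAcyclic) :
    IsIndep G (supportSet G) := by
  rintro u ⟨x, hx, hxu⟩ v ⟨y, hy, hyv⟩ huv
  obtain ⟨C⟩ := hG.colorable_two
  have hC : C u ≠ C v := C.valid huv
  have hx' := restrict_color_mem_nullSpace C (C u) hx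
  have hy' := restrict_color_mem_nullSpace C (C v) hy
  set x' : V → ℝ := fun w ↦ if C w = C u then x w else 0
  set y' : V → ℝ := fun w ↦ if C w = C v then y w else 0
  have hxu' : x' u ≠ 0 := by simpa [x'] using hxu
  have hxv' : x' v = 0 := if_neg hC.symm
  have hyv' : y' v ≠ 0 := by simpa [y'] using hyv
  rw [mem_nullSpace_iff] at hx' hy'
  let T : Finset V := {w | (G.deleteEdges {s(u, v)}).Reachable u w}
  have huT : u ∈ T := by simp [T]
  have hvT : v ∉ T := by
    have := SimpleGraph.isBridge_iff.1 (SimpleGraph.isAcyclic_iff_forall_adj_isBridge.1 hG huv)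
    simpa [T] using this
  have hadj : ∀ a ∈ T, ∀ b, G.Adj a b → b ∈ T ∨ a = u ∧ b = v := by
    intro a ha b hab
    by_cases he : s(a, b) = s(u, v)
    · rcases Sym2.eq_iff.1 he with h | ⟨rfl, rfl⟩
      · exact Or.inr h
      · exact absurd ha hvT
    · left
      simp only [T, Finset.mem_filter, Finset.mem_univ, true_and] at ha ⊢
      refine ha.trans (SimpleGraph.Adj.reachable ?_)
      rw [SimpleGraph.deleteEdges_adj]
      exact ⟨hab, he⟩
  have key : ∀ z : V → ℝ, (∀ w, ∑ b ∈ G.neighborFinset w, z b = 0) → ∀ a ∈ T,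
      ∑ b ∈ T, (if G.Adj a b then z b else 0) = if a = u then -z v else 0 := by
    intro z hz a ha
    have h0 := hz a
    rw [← Finset.sum_filter]
    split_ifs with hau
    · subst hau
      have : G.neighborFinset a = insert v (T.filter (G.Adj a)) := by
        ext b
        simp only [SimpleGraph.mem_neighborFinset, Finset.mem_insert, Finset.mem_filter]
        constructor
        · intro hb
          rcases hadj a ha b hb with h | h
          · exact Or.inr ⟨h, hb⟩
          · exact Or.inl h.2
        · rintro (rfl | h)
          · exact huv
          · exact h.2
      rw [this, Finset.sum_insert (by simp [hvT])] at h0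
      linarith
    · rw [← h0]
      refine Finset.sum_congr ?_ fun _ _ ↦ rfl
      ext b
      simp only [SimpleGraph.mem_neighborFinset, Finset.mem_filter]
      exact ⟨And.right, fun hb ↦ ⟨(hadj a ha b hb).resolve_right fun h ↦ hau h.1, hb⟩⟩
  have hcomm : ∑ a ∈ T, x' a * ∑ b ∈ T, (if G.Adj a b then y' b else 0) =
      ∑ b ∈ T, y' b * ∑ a ∈ T, (if G.Adj b a then x' a else 0) := by
    simp_rw [Finset.mul_sum]
    rw [Finset.sum_comm]
    refine Finset.sum_congr rfl fun b _ ↦ Finset.sum_congr rfl fun a _ ↦ ?_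
    simp only [G.adj_comm a b]
    split_ifs <;> ring
  rw [Finset.sum_congr rfl fun a ha ↦ congrArg (x' a * ·) (key y' hy' a ha),
    Finset.sum_congr rfl fun b hb ↦ congrArg (y' b * ·) (key x' hx' b hb)] at hcomm
  simp [huT, hxv', hxu', hyv'] at hcomm

/-- A neighbor of a supported vertex has a second supported neighbor. -/
lemma exists_ne_adj_mem_supportSet [Fintype V] {G : SimpleGraph V} {u : V}
    (hu : u ∈ coreSet G) :
    ∃ v ∈ supportSet G, ∃ w ∈ supportSet G, G.Adj u v ∧ G.Adj u w ∧ v ≠ w := by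
  obtain ⟨v, ⟨x, hx, hxv⟩, hvu⟩ := hu
  obtain ⟨w, hw, hwv, hxw⟩ : ∃ w, G.Adj u w ∧ w ≠ v ∧ x w ≠ 0 := by
    by_contra! h
    refine hxv ?_
    rw [← mem_nullSpace_iff.1 hx u]
    refine (Finset.sum_eq_single v (fun w hw hwv ↦ ?_) fun hv ↦ ?_).symm
    · exact h w (by simpa using hw) hwv
    · exact absurd (by simpa using hvu.symm) hv
  exact ⟨v, ⟨x, hx, hxv⟩, w, ⟨x, hx, hxw⟩, hvu.symm, hw, hwv.symm⟩

/-- Hall's condition for S-trees: every nonempty subset `U` of the core has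
strictly more supported neighbors than its own cardinality. -/
theorem stmt4 [Fintype V] (S : SimpleGraph V) (hS : IsSTree S)
    (U : Set V) (hU : U ⊆ coreSet S) (hne : U.Nonempty) :
    U.ncard < (nbhdSet S U ∩ supportSet S).ncard := by
  set W := nbhdSet S U ∩ supportSet S
  have hind := isIndep_supportSet hS.1.isAcyclic
  have hdisj : Disjoint U W := by
    rw [Set.disjoint_left]
    rintro a haU ⟨-, haS⟩
    obtain ⟨b, hb, hba⟩ := hU haU
    exact hind b hb a haS hba
  let H : SimpleGraph ↥(U ∪ W) := (S.between U W).induce (U ∪ W)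
  have hH : H.IsAcyclic := (hS.1.isAcyclic.anti SimpleGraph.between_le).induce _
  have hadj {a b : ↥(U ∪ W)} :
      H.Adj a b ↔ S.Adj a b ∧ (a.1 ∈ U ∧ b.1 ∈ W ∨ a.1 ∈ W ∧ b.1 ∈ U) := by
    simp [H, SimpleGraph.between_adj]
  have hlt := card_lt_card_of_two_le_degree hH
    (s := U.toFinset.subtype (· ∈ U ∪ W)) (t := W.toFinset.subtype (· ∈ U ∪ W))
    ⟨?_, ?_⟩ ?_ ?_ ?_
  · rw [Finset.card_subtype, Finset.card_subtype, Finset.filter_true_of_mem,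
      Finset.filter_true_of_mem] at hlt
    · rwa [Set.ncard_eq_toFinset_card', Set.ncard_eq_toFinset_card']
    · exact fun a ha ↦ Or.inr (Set.mem_toFinset.1 ha)
    · exact fun a ha ↦ Or.inl (Set.mem_toFinset.1 ha)
  · rw [Finset.disjoint_coe, Finset.disjoint_left]
    intro a ha hb
    rw [Finset.mem_subtype, Set.mem_toFinset] at ha hb
    exact Set.disjoint_left.1 hdisj ha hb
  · intro a b hab
    simpa only [Finset.mem_coe, Finset.mem_subtype, Set.mem_toFinset] using (hadj.1 hab).2
  · intro p
    simpa only [Finset.mem_union, Finset.mem_subtype, Set.mem_toFinset, Set.mem_union] using p.2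
  · obtain ⟨a, ha⟩ := hne
    exact ⟨⟨a, Or.inl ha⟩, by simpa using ha⟩
  · intro a ha
    rw [Finset.mem_subtype, Set.mem_toFinset] at ha
    obtain ⟨v, hv, w, hw, hav, haw, hvw⟩ := exists_ne_adj_mem_supportSet (hU ha)
    have hvW : v ∈ W := ⟨⟨a, ha, hav⟩, hv⟩
    have hwW : w ∈ W := ⟨⟨a, ha, haw⟩, hw⟩
    rw [← SimpleGraph.card_neighborFinset_eq_degree]
    refine Finset.one_lt_card.2 ⟨⟨v, Or.inr hvW⟩, ?_, ⟨w, Or.inr hwW⟩, ?_, ?_⟩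
    · simpa only [SimpleGraph.mem_neighborFinset] using hadj.2 ⟨hav, Or.inl ⟨ha, hvW⟩⟩
    · simpa only [SimpleGraph.mem_neighborFinset] using hadj.2 ⟨haw, Or.inl ⟨ha, hwW⟩⟩
    · exact fun h ↦ hvw (congrArg Subtype.val h)

end NullDecomp
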